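/- arXiv:1507.01151 — 6 statements merged into one kernel-verified Lean document; each statement's English description precedes it below -/
import Mathlib

section
/- Let n, m ≥ 1, let G ∈ ℝ^{n×m} satisfy G(j,k) ≥ 0 for all j, k and Σ_{j=1}^n G(j,k) = 1 for every k, and let P ∈ ℝ^{n×m} satisfy 0 ≤ P(j,k) ≤ 1 for all j, k and P(j,m) = 1 for all j. Define q_k = Σ_{j=1}^n G(j,k)P(j,k) and X(j,k) = (∏_{l=1}^{k-1}(1 − q_l)) P(j,k). Then for all j and all k ≤ m−1: 0 ≤ X(j,k) ≤ 1 − Σ_{l=1}^{k-1} Σ_{s=1}^n G(s,l) X(s,l); and for all j: X(j,m) = 1 − Σ_{l=1}^{m-1} Σ_{s=1}^n G(s,l) X(s,l). -/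
open Finset

/-- The telescoping identity for a product of complements: the probability of rejecting at every
phase is one minus the total probability of accepting for the first time at some phase. -/
theorem prod_Icc_one_sub_eq {R : Type*} [CommRing R] (q : ℕ → R) (k : ℕ) :
    ∏ l ∈ Finset.Icc 1 k, (1 - q l) =
      1 - ∑ l ∈ Finset.Icc 1 k, (∏ i ∈ Finset.Icc 1 (l - 1), (1 - q i)) * q l := by
  induction k with
  | zero => simp
  | succ k ih =>
    rw [Finset.sum_Icc_succ_top (by lia), ← sub_sub, ← ih, Finset.prod_Icc_succ_top (by lia),
      Nat.add_sub_cancel]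
    ring

/-- For column-stochastic `G` and acceptance probabilities `P` with `P(j,m) = 1`,
the transformed variables `X(j,k) = (∏_{l<k}(1 - q l)) P(j,k)` (with
`q k = ∑_j G(j,k) P(j,k)`) satisfy the feasibility constraints of the linear
program: `0 ≤ X(j,k) ≤ 1 - ∑_{l=1}^{k-1} ∑_{s=1}^n G(s,l) X(s,l)` for `k ≤ m-1`,
and `X(j,m) = 1 - ∑_{l=1}^{m-1} ∑_{s=1}^n G(s,l) X(s,l)`. -/
theorem X_satisfies_LP_constraints (n m : ℕ) (hn : 1 ≤ n) (hm : 1 ≤ m)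
    (G P : ℕ → ℕ → ℝ)
    (hG0 : ∀ j ∈ Finset.Icc 1 n, ∀ k ∈ Finset.Icc 1 m, 0 ≤ G j k)
    (hG1 : ∀ k ∈ Finset.Icc 1 m, ∑ j ∈ Finset.Icc 1 n, G j k = 1)
    (hP : ∀ j ∈ Finset.Icc 1 n, ∀ k ∈ Finset.Icc 1 m, 0 ≤ P j k ∧ P j k ≤ 1)
    (hPm : ∀ j ∈ Finset.Icc 1 n, P j m = 1)
    (q : ℕ → ℝ) (hq : ∀ k, q k = ∑ j ∈ Finset.Icc 1 n, G j k * P j k)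
    (X : ℕ → ℕ → ℝ)
    (hX : ∀ j k, X j k = (∏ l ∈ Finset.Icc 1 (k - 1), (1 - q l)) * P j k) :
    (∀ j ∈ Finset.Icc 1 n, ∀ k ∈ Finset.Icc 1 (m - 1),
        0 ≤ X j k ∧
          X j k ≤ 1 - ∑ l ∈ Finset.Icc 1 (k - 1), ∑ s ∈ Finset.Icc 1 n, G s l * X s l) ∧
      ∀ j ∈ Finset.Icc 1 n,
        X j m = 1 - ∑ l ∈ Finset.Icc 1 (m - 1), ∑ s ∈ Finset.Icc 1 n, G s l * X s l := by
  have hsum : ∀ k, 1 - ∑ l ∈ Finset.Icc 1 k, ∑ s ∈ Finset.Icc 1 n, G s l * X s l =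
      ∏ l ∈ Finset.Icc 1 k, (1 - q l) := by
    intro k
    rw [prod_Icc_one_sub_eq]
    congr 1
    refine Finset.sum_congr rfl fun l _ ↦ ?_
    rw [hq l, Finset.mul_sum]
    exact Finset.sum_congr rfl fun s _ ↦ by rw [hX, mul_left_comm]
  have hq1 : ∀ k ∈ Finset.Icc 1 m, q k ≤ 1 := by
    intro k hk
    rw [hq, ← hG1 k hk]
    exact Finset.sum_le_sum fun j hj ↦ mul_le_of_le_one_right (hG0 j hj k hk) (hP j hj k hk).2
  refine ⟨fun j hj k hk ↦ ?_, fun j hj ↦ by rw [hsum, hX, hPm j hj, mul_one]⟩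
  rw [Finset.mem_Icc] at hk
  have hprod : 0 ≤ ∏ l ∈ Finset.Icc 1 (k - 1), (1 - q l) := by
    refine Finset.prod_nonneg fun l hl ↦ sub_nonneg.2 (hq1 l ?_)
    rw [Finset.mem_Icc] at hl ⊢
    lia
  obtain ⟨hP0, hP1⟩ := hP j hj k (Finset.mem_Icc.2 (by lia))
  rw [hsum, hX]
  exact ⟨mul_nonneg hprod hP0, mul_le_of_le_one_right hprod hP1⟩
end

section
/- Let n, m ≥ 1, let G ∈ ℝ^{n×m} satisfy G(j,k) ≥ 0 for all j, k and Σ_{j=1}^n G(j,k) = 1 for every k, and let P ∈ ℝ^{n×m} satisfy 0 ≤ P(j,k) ≤ 1 for all j, k and P(j,m) = 1 for all j. Define q_k = Σ_{j=1}^n G(j,k)P(j,k), X(j,k) = (∏_{l=1}^{k-1}(1 − q_l)) P(j,k), and z(k) = 1 − Σ_{l=1}^{k-1} Σ_{s=1}^n G(s,l) X(s,l). Then for every j, k with z(k) > 0, P(j,k) = X(j,k)/z(k). -/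
open Finset

/-- Telescoping: the mass not yet removed after `i` steps is the product of the survival factors. -/
theorem one_sub_sum_prod_mul_eq_prod {R : Type*} [CommRing R] (q : ℕ → R) (i : ℕ) :
    1 - ∑ l ∈ Finset.Icc 1 i, (∏ r ∈ Finset.Icc 1 (l - 1), (1 - q r)) * q l =
      ∏ l ∈ Finset.Icc 1 i, (1 - q l) := by
  induction i with
  | zero => simp
  | succ i ih =>
    rw [Finset.sum_Icc_succ_top (Nat.le_add_left 1 i),
      Finset.prod_Icc_succ_top (Nat.le_add_left 1 i), Nat.add_sub_cancel, ← sub_sub, ih]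
    ring

/-- For column-stochastic `G` and acceptance probabilities `P` with `P(j,m) = 1`,
setting `q k = ∑_j G(j,k) P(j,k)`, `X(j,k) = (∏_{l<k}(1 - q l)) P(j,k)` and
`z k = 1 - ∑_{l=1}^{k-1} ∑_{s=1}^n G(s,l) X(s,l)`, the change of variables is
invertible on phases reached with positive probability:
if `z k > 0` then `P(j,k) = X(j,k) / z k`. -/
theorem P_recovered_from_X (n m : ℕ) (hn : 1 ≤ n) (hm : 1 ≤ m)
    (G P : ℕ → ℕ → ℝ)
    (hG0 : ∀ j ∈ Finset.Icc 1 n, ∀ k ∈ Finset.Icc 1 m, 0 ≤ G j k)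
    (hG1 : ∀ k ∈ Finset.Icc 1 m, ∑ j ∈ Finset.Icc 1 n, G j k = 1)
    (hP : ∀ j ∈ Finset.Icc 1 n, ∀ k ∈ Finset.Icc 1 m, 0 ≤ P j k ∧ P j k ≤ 1)
    (hPm : ∀ j ∈ Finset.Icc 1 n, P j m = 1)
    (q : ℕ → ℝ) (hq : ∀ k, q k = ∑ j ∈ Finset.Icc 1 n, G j k * P j k)
    (X : ℕ → ℕ → ℝ)
    (hX : ∀ j k, X j k = (∏ l ∈ Finset.Icc 1 (k - 1), (1 - q l)) * P j k)
    (z : ℕ → ℝ)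
    (hz : ∀ k, z k = 1 - ∑ l ∈ Finset.Icc 1 (k - 1), ∑ s ∈ Finset.Icc 1 n, G s l * X s l) :
    ∀ j ∈ Finset.Icc 1 n, ∀ k ∈ Finset.Icc 1 m, 0 < z k → P j k = X j k / z k := by
  intro j _ k _ hzk
  have inner_sum (l : ℕ) : ∑ s ∈ Finset.Icc 1 n, G s l * X s l =
      (∏ r ∈ Finset.Icc 1 (l - 1), (1 - q r)) * q l := by
    rw [hq l, Finset.mul_sum]
    refine Finset.sum_congr rfl fun s _ => ?_
    rw [hX]
    ring
  have z_eq : z k = ∏ l ∈ Finset.Icc 1 (k - 1), (1 - q l) := by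
    simp_rw [hz, inner_sum]
    exact one_sub_sum_prod_mul_eq_prod q (k - 1)
  rw [eq_div_iff hzk.ne', hX, ← z_eq, mul_comm]
end

section
/- Let n, m ≥ 1 and let G ∈ ℝ^{n×m} satisfy G(j,k) ≥ 0 for all j, k and Σ_{j=1}^n G(j,k) = 1 for every k. Let X ∈ ℝ^{n×m} satisfy: for all j and k ≤ m−1, 0 ≤ X(j,k) ≤ 1 − Σ_{l=1}^{k-1} Σ_{s=1}^n G(s,l) X(s,l), and for all j, X(j,m) = 1 − Σ_{l=1}^{m-1} Σ_{s=1}^n G(s,l) X(s,l). Then there exists P ∈ ℝ^{n×m} with 0 ≤ P(j,k) ≤ 1 for all j, k and P(j,m) = 1 for all j, such that, setting q_k = Σ_{j=1}^n G(j,k)P(j,k), one has X(j,k) = (∏_{l=1}^{k-1}(1 − q_l)) P(j,k) for all j, k. -/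
open Finset

/-- Surjectivity of the change of variables `P ↦ X`: every `X` feasible for the
linear program arises from an acceptance policy `P ∈ C` (with `P(j,m) = 1`),
i.e. `X(j,k) = (∏_{l<k}(1 - q l)) P(j,k)` where `q k = ∑_j G(j,k) P(j,k)`. -/
theorem LP_feasible_realized_by_policy (n m : ℕ) (hn : 1 ≤ n) (hm : 1 ≤ m)
    (G : ℕ → ℕ → ℝ)
    (hG0 : ∀ j ∈ Finset.Icc 1 n, ∀ k ∈ Finset.Icc 1 m, 0 ≤ G j k)
    (hG1 : ∀ k ∈ Finset.Icc 1 m, ∑ j ∈ Finset.Icc 1 n, G j k = 1)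
    (X : ℕ → ℕ → ℝ)
    (hX1 : ∀ j ∈ Finset.Icc 1 n, ∀ k ∈ Finset.Icc 1 (m - 1),
        0 ≤ X j k ∧
          X j k ≤ 1 - ∑ l ∈ Finset.Icc 1 (k - 1), ∑ s ∈ Finset.Icc 1 n, G s l * X s l)
    (hX2 : ∀ j ∈ Finset.Icc 1 n,
        X j m = 1 - ∑ l ∈ Finset.Icc 1 (m - 1), ∑ s ∈ Finset.Icc 1 n, G s l * X s l) :
    ∃ P : ℕ → ℕ → ℝ,
      (∀ j ∈ Finset.Icc 1 n, ∀ k ∈ Finset.Icc 1 m, 0 ≤ P j k ∧ P j k ≤ 1) ∧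
      (∀ j ∈ Finset.Icc 1 n, P j m = 1) ∧
      ∀ j ∈ Finset.Icc 1 n, ∀ k ∈ Finset.Icc 1 m,
        X j k = (∏ l ∈ Finset.Icc 1 (k - 1),
            (1 - ∑ i ∈ Finset.Icc 1 n, G i l * P i l)) * P j k := by
  set T : ℕ → ℝ := fun t =>
    1 - ∑ l ∈ Finset.Icc 1 t, ∑ s ∈ Finset.Icc 1 n, G s l * X s l with hT
  have hT_zero : T 0 = 1 := by simp [hT]
  have hT_succ : ∀ t, T (t + 1) = T t - ∑ s ∈ Finset.Icc 1 n, G s (t + 1) * X s (t + 1) := by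
    intro t
    simp only [hT]
    rw [Finset.sum_Icc_succ_top (by omega)]
    ring
  have hT_nonneg : ∀ t, t + 1 ≤ m → 0 ≤ T t := by
    intro t ht
    cases t with
    | zero => simp [hT_zero]
    | succ t =>
      have h : ∑ s ∈ Finset.Icc 1 n, G s (t + 1) * X s (t + 1)
          ≤ ∑ s ∈ Finset.Icc 1 n, G s (t + 1) * T t := by
        refine Finset.sum_le_sum fun s hs => mul_le_mul_of_nonneg_left ?_ ?_
        · exact (hX1 s hs (t + 1) (Finset.mem_Icc.2 ⟨by omega, by omega⟩)).2
        · exact hG0 s hs (t + 1) (Finset.mem_Icc.2 ⟨by omega, by omega⟩)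
      rw [← Finset.sum_mul, hG1 (t + 1) (Finset.mem_Icc.2 ⟨by omega, by omega⟩), one_mul] at h
      rw [hT_succ]
      linarith
  have hX : ∀ j ∈ Finset.Icc 1 n, ∀ t, t + 1 ≤ m → 0 ≤ X j (t + 1) ∧ X j (t + 1) ≤ T t := by
    intro j hj t ht
    rcases ht.eq_or_lt with rfl | hlt
    · have h : X j (t + 1) = T t := hX2 j hj
      exact ⟨h ▸ hT_nonneg t ht, h.le⟩
    · exact hX1 j hj (t + 1) (Finset.mem_Icc.2 ⟨by omega, by omega⟩)
  set P : ℕ → ℕ → ℝ := fun j k => if T (k - 1) = 0 then 1 else X j k / T (k - 1) with hP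
  have hTP : ∀ j ∈ Finset.Icc 1 n, ∀ t, t + 1 ≤ m → T t * P j (t + 1) = X j (t + 1) := by
    intro j hj t ht
    simp only [hP, Nat.add_sub_cancel]
    split_ifs with h0
    · have h := hX j hj t ht
      rw [h0] at h ⊢
      linarith [h.1, h.2]
    · exact mul_div_cancel₀ _ h0
  have hprod : ∀ t, t + 1 ≤ m →
      ∏ l ∈ Finset.Icc 1 t, (1 - ∑ i ∈ Finset.Icc 1 n, G i l * P i l) = T t := by
    intro t
    induction t with
    | zero => simp [hT_zero]
    | succ t ih =>
      intro ht
      rw [Finset.prod_Icc_succ_top (by omega), ih (by omega), hT_succ, mul_sub, mul_one,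
        Finset.mul_sum]
      congr 1
      refine Finset.sum_congr rfl fun i hi => ?_
      rw [← hTP i hi t (by omega)]
      ring
  refine ⟨P, ?_, ?_, ?_⟩
  · intro j hj k hk
    obtain ⟨hk1, hkm⟩ := Finset.mem_Icc.1 hk
    obtain ⟨t, rfl⟩ := Nat.exists_eq_add_of_le' hk1
    have h := hX j hj t hkm
    have h_nonneg := hT_nonneg t hkm
    simp only [hP, Nat.add_sub_cancel]
    split_ifs
    · norm_num
    · exact ⟨div_nonneg h.1 h_nonneg, div_le_one_of_le₀ h.2 h_nonneg⟩
  · intro j hj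
    have h : X j m = T (m - 1) := hX2 j hj
    simp only [hP, h]
    split_ifs with h0
    · rfl
    · exact div_self h0
  · intro j hj k hk
    obtain ⟨hk1, hkm⟩ := Finset.mem_Icc.1 hk
    obtain ⟨t, rfl⟩ := Nat.exists_eq_add_of_le' hk1
    rw [Nat.add_sub_cancel, hprod t hkm, hTP j hj t hkm]
end

section
/- Let n, m ≥ 1, let G ∈ ℝ^{n×m} satisfy G(j,k) ≥ 0 for all j, k and Σ_{j=1}^n G(j,k) = 1 for every k, and let H ∈ ℝ^{n×m} be arbitrary. Let C be the set of P ∈ ℝ^{n×m} with 0 ≤ P(j,k) ≤ 1 for all j, k and P(j,m) = 1 for all j; for P ∈ C set q_k(P) = Σ_j G(j,k)P(j,k) and X_P(j,k) = (∏_{l=1}^{k-1}(1 − q_l(P))) P(j,k). Let F be the set of X ∈ ℝ^{n×m} with 0 ≤ X(j,k) ≤ 1 − Σ_{l=1}^{k-1} Σ_{s=1}^n G(s,l) X(s,l) for all j and k ≤ m−1, and X(j,m) = 1 − Σ_{l=1}^{m-1} Σ_{s=1}^n G(s,l) X(s,l) for all j. Then sup_{P ∈ C} Σ_{j,k} H(j,k)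 X_P(j,k) = sup_{X ∈ F} Σ_{j,k} H(j,k) X(j,k), and both suprema are attained. -/
open Finset

/-- The survival probabilities of a policy `P` are affine in the transformed variables. -/
lemma prod_one_sub_eq_of_eq_prod_mul (n : ℕ) (G P X : ℕ → ℕ → ℝ)
    (hX : ∀ s l, X s l = (∏ i ∈ Icc 1 (l - 1), (1 - ∑ t ∈ Icc 1 n, G t i * P t i)) * P s l)
    (K : ℕ) :
    ∏ l ∈ Icc 1 K, (1 - ∑ i ∈ Icc 1 n, G i l * P i l) =
      1 - ∑ l ∈ Icc 1 K, ∑ s ∈ Icc 1 n, G s l * X s l := by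
  induction K with
  | zero => simp
  | succ K ih =>
    have h : ∑ s ∈ Icc 1 n, G s (K + 1) * X s (K + 1) =
        (∏ l ∈ Icc 1 K, (1 - ∑ i ∈ Icc 1 n, G i l * P i l)) *
          ∑ s ∈ Icc 1 n, G s (K + 1) * P s (K + 1) := by
      rw [mul_sum]
      refine sum_congr rfl fun s _ => ?_
      rw [hX, Nat.add_sub_cancel]
      ring
    rw [prod_Icc_succ_top (by omega), sum_Icc_succ_top (by omega), h, ← sub_sub, ← ih]
    ring

/-- If `P` is obtained from `X` by dividing by the remaining mass, then the remaining mass is the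
survival probability of `P`. -/
lemma prod_one_sub_eq_of_eq_sub_mul (n : ℕ) (G P X : ℕ → ℕ → ℝ) (K : ℕ)
    (hX : ∀ s ∈ Icc 1 n, ∀ l ∈ Icc 1 K,
      X s l = (1 - ∑ i ∈ Icc 1 (l - 1), ∑ t ∈ Icc 1 n, G t i * X t i) * P s l) :
    ∏ l ∈ Icc 1 K, (1 - ∑ i ∈ Icc 1 n, G i l * P i l) =
      1 - ∑ l ∈ Icc 1 K, ∑ s ∈ Icc 1 n, G s l * X s l := by
  induction K with
  | zero => simp
  | succ K ih =>
    have h : ∑ s ∈ Icc 1 n, G s (K + 1) * X s (K + 1) =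
        (1 - ∑ l ∈ Icc 1 K, ∑ s ∈ Icc 1 n, G s l * X s l) *
          ∑ s ∈ Icc 1 n, G s (K + 1) * P s (K + 1) := by
      rw [mul_sum]
      refine sum_congr rfl fun s hs => ?_
      rw [hX s hs (K + 1) (by simp), Nat.add_sub_cancel]
      ring
    rw [prod_Icc_succ_top (by omega), sum_Icc_succ_top (by omega), h, ← sub_sub,
      ih fun s hs l hl => hX s hs l (Icc_subset_Icc_right K.le_succ hl)]
    ring

/-- A continuous objective that depends only on the entries `P j k` with `1 ≤ j ≤ n`, `1 ≤ k ≤ m`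
attains its maximum over the acceptance policies. -/
lemma exists_isGreatest_acceptance_policy (n m : ℕ) (f : (ℕ → ℕ → ℝ) → ℝ) (hf : Continuous f)
    (hcongr : ∀ P Q : ℕ → ℕ → ℝ,
      (∀ j ∈ Icc 1 n, ∀ k ∈ Icc 1 m, P j k = Q j k) → f P = f Q) :
    ∃ v : ℝ, IsGreatest
      {w : ℝ | ∃ P : ℕ → ℕ → ℝ,
        ((∀ j ∈ Icc 1 n, ∀ k ∈ Icc 1 m, 0 ≤ P j k ∧ P j k ≤ 1) ∧
          ∀ j ∈ Icc 1 n, P j m = 1) ∧ w = f P} v := by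
  let T : ℕ → Set ℝ := fun k => if k = m then {1} else Set.Icc 0 1
  have hT : ∀ k, IsCompact (T k) := fun k => by
    by_cases hk : k = m
    · simp [T, hk]
    · simpa [T, hk] using isCompact_Icc
  have hT1 : ∀ k x, x ∈ T k → 0 ≤ x ∧ x ≤ 1 := fun k x hx => by
    by_cases hk : k = m
    · have : x = 1 := by simpa [T, hk] using hx
      simp [this]
    · simpa [T, hk] using hx
  have hTone : ∀ k, (1 : ℝ) ∈ T k := fun k => by
    by_cases hk : k = m <;> simp [T, hk]
  have hcompact : IsCompact
      (Set.univ.pi fun _ : ℕ => Set.univ.pi fun k : ℕ => T k) :=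
    isCompact_univ_pi fun _ => isCompact_univ_pi hT
  obtain ⟨P, hP, hmax⟩ := hcompact.exists_isMaxOn
    ⟨fun _ _ => 1, fun _ _ k _ => hTone k⟩ hf.continuousOn
  refine ⟨f P, ⟨P, ⟨fun j _ k _ => hT1 k _ (hP j trivial k trivial), fun j _ => ?_⟩, rfl⟩, ?_⟩
  · simpa [T] using hP j trivial m trivial
  · rintro w ⟨Q, ⟨hQ, hQm⟩, rfl⟩
    let Q' : ℕ → ℕ → ℝ := fun j k => if j ∈ Icc 1 n ∧ k ∈ Icc 1 m then Q j k else 1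
    rw [hcongr Q Q' fun j hj k hk => (if_pos ⟨hj, hk⟩).symm]
    refine hmax fun j _ k _ => ?_
    by_cases h : j ∈ Icc 1 n ∧ k ∈ Icc 1 m
    · have hQ' : Q' j k = Q j k := if_pos h
      rw [hQ']
      by_cases hk : k = m
      · simp [T, hk, hQm j h.1]
      · simpa [T, hk] using hQ j h.1 k h.2
    · have hQ' : Q' j k = 1 := if_neg h
      rw [hQ']
      exact hTone k

/-- The per-state, per-epoch maximization of the backward induction over
acceptance policies `P ∈ C` has the same (attained) optimal value as the linear
program over the transformed variables `X ∈ F`: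
`max_{P ∈ C} ∑_{j,k} H(j,k) X_P(j,k) = max_{X ∈ F} ∑_{j,k} H(j,k) X(j,k)`. -/
theorem seqMDP_bellman_eq_LP (n m : ℕ) (hn : 1 ≤ n) (hm : 1 ≤ m)
    (G H : ℕ → ℕ → ℝ)
    (hG0 : ∀ j ∈ Finset.Icc 1 n, ∀ k ∈ Finset.Icc 1 m, 0 ≤ G j k)
    (hG1 : ∀ k ∈ Finset.Icc 1 m, ∑ j ∈ Finset.Icc 1 n, G j k = 1) :
    ∃ v : ℝ,
      IsGreatest
        {w : ℝ | ∃ P : ℕ → ℕ → ℝ,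
          ((∀ j ∈ Finset.Icc 1 n, ∀ k ∈ Finset.Icc 1 m, 0 ≤ P j k ∧ P j k ≤ 1) ∧
            ∀ j ∈ Finset.Icc 1 n, P j m = 1) ∧
          w = ∑ j ∈ Finset.Icc 1 n, ∑ k ∈ Finset.Icc 1 m,
            H j k * ((∏ l ∈ Finset.Icc 1 (k - 1),
              (1 - ∑ i ∈ Finset.Icc 1 n, G i l * P i l)) * P j k)} v ∧
      IsGreatest
        {w : ℝ | ∃ X : ℕ → ℕ → ℝ,
          ((∀ j ∈ Finset.Icc 1 n, ∀ k ∈ Finset.Icc 1 (m - 1),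
              0 ≤ X j k ∧
                X j k ≤ 1 - ∑ l ∈ Finset.Icc 1 (k - 1),
                  ∑ s ∈ Finset.Icc 1 n, G s l * X s l) ∧
            ∀ j ∈ Finset.Icc 1 n,
              X j m = 1 - ∑ l ∈ Finset.Icc 1 (m - 1),
                ∑ s ∈ Finset.Icc 1 n, G s l * X s l) ∧
          w = ∑ j ∈ Finset.Icc 1 n, ∑ k ∈ Finset.Icc 1 m, H j k * X j k} v := by
  obtain ⟨v, hv⟩ := exists_isGreatest_acceptance_policy n m
    (fun P => ∑ j ∈ Icc 1 n, ∑ k ∈ Icc 1 m,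
      H j k * ((∏ l ∈ Icc 1 (k - 1), (1 - ∑ i ∈ Icc 1 n, G i l * P i l)) * P j k))
    (by fun_prop) (fun P Q hPQ => by
      refine sum_congr rfl fun j hj => sum_congr rfl fun k hk => ?_
      rw [hPQ j hj k hk]
      congr 2
      refine prod_congr rfl fun l hl => ?_
      congr 1
      refine sum_congr rfl fun i hi => ?_
      rw [hPQ i hi l (by simp only [mem_Icc] at hk hl ⊢; omega)])
  refine ⟨v, hv, ?_⟩
  convert hv using 1
  ext w
  constructor
  · rintro ⟨X, ⟨hX, hXm⟩, rfl⟩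
    let R : ℕ → ℝ := fun k => 1 - ∑ l ∈ Icc 1 (k - 1), ∑ s ∈ Icc 1 n, G s l * X s l
    let P : ℕ → ℕ → ℝ := fun j k => if k = m then 1 else X j k / R k
    have hPm : ∀ j, P j m = 1 := fun j => if_pos rfl
    have hlt : ∀ k ∈ Icc 1 m, k ≠ m → k ∈ Icc 1 (m - 1) := fun k hk hkm => by
      simp only [mem_Icc] at hk ⊢
      omega
    have hXP : ∀ j ∈ Icc 1 n, ∀ k ∈ Icc 1 m, X j k = R k * P j k := fun j hj k hk => by
      by_cases hkm : k = m
      · subst hkm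
        rw [hPm, mul_one]
        exact hXm j hj
      · have hP : P j k = X j k / R k := if_neg hkm
        have hb : 0 ≤ X j k ∧ X j k ≤ R k := hX j hj k (hlt k hk hkm)
        rw [hP]
        by_cases hR : R k = 0
        · rw [hR] at hb ⊢
          linarith [hb.1, hb.2]
        · field_simp
    refine ⟨P, ⟨fun j hj k hk => ?_, fun j _ => hPm j⟩, ?_⟩
    · by_cases hkm : k = m
      · simp [P, hkm]
      · have hP : P j k = X j k / R k := if_neg hkm
        have hb : 0 ≤ X j k ∧ X j k ≤ R k := hX j hj k (hlt k hk hkm)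
        have hR : 0 ≤ R k := hb.1.trans hb.2
        rw [hP]
        exact ⟨div_nonneg hb.1 hR, div_le_one_of_le₀ hb.2 hR⟩
    · refine sum_congr rfl fun j hj => sum_congr rfl fun k hk => ?_
      rw [prod_one_sub_eq_of_eq_sub_mul n G P X (k - 1) fun s hs l hl =>
        hXP s hs l (by simp only [mem_Icc] at hk hl ⊢; omega), hXP j hj k hk]
  · rintro ⟨P, ⟨hP, hPm⟩, rfl⟩
    let X : ℕ → ℕ → ℝ := fun j k =>
      (∏ l ∈ Icc 1 (k - 1), (1 - ∑ i ∈ Icc 1 n, G i l * P i l)) * P j k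
    have hS := prod_one_sub_eq_of_eq_prod_mul n G P X fun _ _ => rfl
    refine ⟨X, ⟨fun j hj k hk => ?_, fun j hj => ?_⟩, rfl⟩
    · have hkm : k ∈ Icc 1 m := Icc_subset_Icc_right (Nat.sub_le m 1) hk
      have hS0 : 0 ≤ ∏ l ∈ Icc 1 (k - 1), (1 - ∑ i ∈ Icc 1 n, G i l * P i l) := by
        refine prod_nonneg fun l hl => ?_
        have hlm : l ∈ Icc 1 m := by
          simp only [mem_Icc] at hkm hl ⊢
          omega
        rw [sub_nonneg, ← hG1 l hlm]
        exact sum_le_sum fun i hi => mul_le_of_le_one_right (hG0 i hi l hlm) (hP i hi l hlm).2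
      rw [← hS]
      exact ⟨mul_nonneg hS0 (hP j hj k hkm).1, mul_le_of_le_one_right hS0 (hP j hj k hkm).2⟩
    · rw [← hS]
      simp only [X, hPm j hj, mul_one]
end

section
/- Let n, m ≥ 1 and N ≥ 2. For each state i ∈ {1,…,n} and epoch t ∈ {1,…,N−1}, let G_i ∈ ℝ^{n×m} satisfy G_i(j,k) ≥ 0 and Σ_{j=1}^n G_i(j,k) = 1 for every k, and let r_t(i,·) ∈ ℝ^m and r_N ∈ ℝ^n be rewards. Let C ⊆ ℝ^{n×m} be the set of P with 0 ≤ P(j,k) ≤ 1 for all j,k and P(j,m) = 1 for all j. For P ∈ C define q_{i,k}(P) = Σ_j G_i(j,k)P(j,k), ρ_{i,t}(P) = Σ_{k=1}^m (∏_{l=1}^{k-1}(1 − q_{i,l}(P))) q_{i,k}(P) r_t(i,a_k), and μ_i(P)(j) = Σ_{k=1}^m (∏_{l=1}^{k-1}(1 − q_{i,l}(P))) G_i(j,k) P(j,k). Define J_N(x) = Σ_j x_j r_N(j) and, for t = N−1, …, 1, J_t(x) = sup over (P_1,…,P_n) ∈ C^n of [ Σ_i x_i ρ_{i,t}(P_i)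 + J_{t+1}(y) ] where y_j = Σ_i μ_i(P_i)(j) x_i. Define V*_N(i) = r_N(i) and V*_t(i) = sup_{P ∈ C} [ ρ_{i,t}(P) + Σ_j μ_i(P)(j) V*_{t+1}(j) ]. Then for every t ∈ {1,…,N} and every x ∈ ℝ^n with x_i ≥ 0 for all i, J_t(x) = Σ_i x_i V*_t(i). -/
open Finset

/-- The acceptance probability `q_k(P) = ∑_j G(j,k) P(j,k)` of phase `k`. -/
def seqQ (n : ℕ) (G P : ℕ → ℕ → ℝ) (k : ℕ) : ℝ :=
  ∑ j ∈ Finset.Icc 1 n, G j k * P j k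

/-- The set `C` of acceptance-probability matrices:
entries in `[0,1]` and acceptance forced at the last phase `m`. -/
def seqC (n m : ℕ) (P : ℕ → ℕ → ℝ) : Prop :=
  (∀ j ∈ Finset.Icc 1 n, ∀ k ∈ Finset.Icc 1 m, 0 ≤ P j k ∧ P j k ≤ 1) ∧
    ∀ j ∈ Finset.Icc 1 n, P j m = 1

/-- Expected immediate reward
`ρ(P) = ∑_{k=1}^m (∏_{l<k}(1 - q_l(P))) q_k(P) r(a_k)`. -/
def seqRho (n m : ℕ) (G P : ℕ → ℕ → ℝ) (r : ℕ → ℝ) : ℝ :=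
  ∑ k ∈ Finset.Icc 1 m,
    (∏ l ∈ Finset.Icc 1 (k - 1), (1 - seqQ n G P l)) * (seqQ n G P k * r k)

/-- Induced one-step transition probability
`μ(P)(j) = ∑_{k=1}^m (∏_{l<k}(1 - q_l(P))) G(j,k) P(j,k)`. -/
def seqMu (n m : ℕ) (G P : ℕ → ℕ → ℝ) (j : ℕ) : ℝ :=
  ∑ k ∈ Finset.Icc 1 m,
    (∏ l ∈ Finset.Icc 1 (k - 1), (1 - seqQ n G P l)) * (G j k * P j k)

theorem sSup_sum_mul_separable {ι α : Type*} (s : Finset ι) (x : ι → ℝ)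
    (hx : ∀ i ∈ s, 0 ≤ x i) (C : α → Prop) (hC : ∃ p, C p) (f : ι → α → ℝ)
    (hf : ∀ i ∈ s, ∃ B, ∀ p, C p → f i p ≤ B) :
    sSup {v : ℝ | ∃ P : ι → α, (∀ i ∈ s, C (P i)) ∧ v = ∑ i ∈ s, x i * f i (P i)} =
      ∑ i ∈ s, x i * sSup {v : ℝ | ∃ p, C p ∧ v = f i p} := by
  obtain ⟨p₀, hp₀⟩ := hC
  have hbdd : ∀ i ∈ s, BddAbove {v : ℝ | ∃ p, C p ∧ v = f i p} := by
    intro i hi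
    obtain ⟨B, hB⟩ := hf i hi
    exact ⟨B, by rintro _ ⟨p, hp, rfl⟩; exact hB p hp⟩
  refine IsLUB.csSup_eq ?_ ⟨_, fun _ => p₀, fun _ _ => hp₀, rfl⟩
  constructor
  · rintro _ ⟨P, hP, rfl⟩
    exact Finset.sum_le_sum fun i hi => mul_le_mul_of_nonneg_left
      (le_csSup (hbdd i hi) ⟨P i, hP i hi, rfl⟩) (hx i hi)
  · intro b hb
    have hX : 0 ≤ ∑ i ∈ s, x i := Finset.sum_nonneg hx
    have key : ∀ δ > 0, ∑ i ∈ s, x i * sSup {v : ℝ | ∃ p, C p ∧ v = f i p} ≤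
        b + (∑ i ∈ s, x i) * δ := by
      intro δ hδ
      have hex : ∀ i, ∃ p, C p ∧ sSup {v : ℝ | ∃ p, C p ∧ v = f i p} - δ < f i p := by
        intro i
        obtain ⟨_, ⟨p, hp, rfl⟩, h⟩ := exists_lt_of_lt_csSup
          (s := {v : ℝ | ∃ p, C p ∧ v = f i p}) ⟨_, p₀, hp₀, rfl⟩ (sub_lt_self _ hδ)
        exact ⟨p, hp, h⟩
      choose P hP hlt using hex
      have hPb := hb ⟨P, fun i _ => hP i, rfl⟩
      have hle : ∑ i ∈ s, x i * sSup {v : ℝ | ∃ p, C p ∧ v = f i p} ≤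
          ∑ i ∈ s, (x i * f i (P i) + x i * δ) := by
        refine Finset.sum_le_sum fun i hi => ?_
        rw [← mul_add]
        exact mul_le_mul_of_nonneg_left (by linarith [hlt i]) (hx i hi)
      rw [Finset.sum_add_distrib, ← Finset.sum_mul] at hle
      linarith
    refine le_of_forall_pos_le_add fun ε hε => ?_
    have hX1 : 0 < (∑ i ∈ s, x i) + 1 := by linarith
    refine (key (ε / ((∑ i ∈ s, x i) + 1)) (by positivity)).trans ?_
    have : (∑ i ∈ s, x i) * (ε / ((∑ i ∈ s, x i) + 1)) ≤ ε := by
      rw [← mul_div_assoc, div_le_iff₀ hX1]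
      nlinarith
    linarith

section Bounds

variable {n m : ℕ} {G P : ℕ → ℕ → ℝ}

theorem seqC_one (n m : ℕ) : seqC n m fun _ _ => 1 :=
  ⟨fun _ _ _ _ => ⟨zero_le_one, le_rfl⟩, fun _ _ => rfl⟩

theorem seqQ_mem_Icc (hG0 : ∀ j ∈ Finset.Icc 1 n, ∀ k ∈ Finset.Icc 1 m, 0 ≤ G j k)
    (hG1 : ∀ k ∈ Finset.Icc 1 m, ∑ j ∈ Finset.Icc 1 n, G j k = 1) (hP : seqC n m P)
    {k : ℕ} (hk : k ∈ Finset.Icc 1 m) : seqQ n G P k ∈ Set.Icc (0 : ℝ) 1 := by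
  refine ⟨Finset.sum_nonneg fun j hj => mul_nonneg (hG0 j hj k hk) (hP.1 j hj k hk).1, ?_⟩
  rw [← hG1 k hk]
  exact Finset.sum_le_sum fun j hj => mul_le_of_le_one_right (hG0 j hj k hk) (hP.1 j hj k hk).2

theorem prod_one_sub_seqQ_mem_Icc
    (hG0 : ∀ j ∈ Finset.Icc 1 n, ∀ k ∈ Finset.Icc 1 m, 0 ≤ G j k)
    (hG1 : ∀ k ∈ Finset.Icc 1 m, ∑ j ∈ Finset.Icc 1 n, G j k = 1) (hP : seqC n m P)
    {k : ℕ} (hk : k ∈ Finset.Icc 1 m) :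
    ∏ l ∈ Finset.Icc 1 (k - 1), (1 - seqQ n G P l) ∈ Set.Icc (0 : ℝ) 1 := by
  have h : ∀ l ∈ Finset.Icc 1 (k - 1), 1 - seqQ n G P l ∈ Set.Icc (0 : ℝ) 1 := by
    intro l hl
    have hl' : l ∈ Finset.Icc 1 m := by
      simp only [Finset.mem_Icc] at hl hk ⊢
      omega
    obtain ⟨h0, h1⟩ := seqQ_mem_Icc hG0 hG1 hP hl'
    exact ⟨by linarith, by linarith⟩
  exact ⟨Finset.prod_nonneg fun l hl => (h l hl).1,
    Finset.prod_le_one (fun l hl => (h l hl).1) fun l hl => (h l hl).2⟩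

theorem seqMu_nonneg (hG0 : ∀ j ∈ Finset.Icc 1 n, ∀ k ∈ Finset.Icc 1 m, 0 ≤ G j k)
    (hG1 : ∀ k ∈ Finset.Icc 1 m, ∑ j ∈ Finset.Icc 1 n, G j k = 1) (hP : seqC n m P)
    {j : ℕ} (hj : j ∈ Finset.Icc 1 n) : 0 ≤ seqMu n m G P j :=
  Finset.sum_nonneg fun k hk => mul_nonneg (prod_one_sub_seqQ_mem_Icc hG0 hG1 hP hk).1
    (mul_nonneg (hG0 j hj k hk) (hP.1 j hj k hk).1)

theorem seqMu_le (hG0 : ∀ j ∈ Finset.Icc 1 n, ∀ k ∈ Finset.Icc 1 m, 0 ≤ G j k)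
    (hG1 : ∀ k ∈ Finset.Icc 1 m, ∑ j ∈ Finset.Icc 1 n, G j k = 1) (hP : seqC n m P)
    {j : ℕ} (hj : j ∈ Finset.Icc 1 n) :
    seqMu n m G P j ≤ ∑ k ∈ Finset.Icc 1 m, G j k :=
  Finset.sum_le_sum fun k hk =>
    (mul_le_of_le_one_left (mul_nonneg (hG0 j hj k hk) (hP.1 j hj k hk).1)
      (prod_one_sub_seqQ_mem_Icc hG0 hG1 hP hk).2).trans
      (mul_le_of_le_one_right (hG0 j hj k hk) (hP.1 j hj k hk).2)

theorem seqRho_le (hG0 : ∀ j ∈ Finset.Icc 1 n, ∀ k ∈ Finset.Icc 1 m, 0 ≤ G j k)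
    (hG1 : ∀ k ∈ Finset.Icc 1 m, ∑ j ∈ Finset.Icc 1 n, G j k = 1) (hP : seqC n m P)
    (r : ℕ → ℝ) : seqRho n m G P r ≤ ∑ k ∈ Finset.Icc 1 m, |r k| := by
  refine Finset.sum_le_sum fun k hk => ?_
  obtain ⟨hp0, hp1⟩ := prod_one_sub_seqQ_mem_Icc hG0 hG1 hP hk
  obtain ⟨hq0, hq1⟩ := seqQ_mem_Icc hG0 hG1 hP hk
  rw [← mul_assoc]
  exact (mul_le_mul_of_nonneg_left (le_abs_self _) (mul_nonneg hp0 hq0)).trans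
    (mul_le_of_le_one_left (abs_nonneg _) (mul_le_one₀ hp1 hq0 hq1))

theorem exists_forall_seqRho_add_sum_le
    (hG0 : ∀ j ∈ Finset.Icc 1 n, ∀ k ∈ Finset.Icc 1 m, 0 ≤ G j k)
    (hG1 : ∀ k ∈ Finset.Icc 1 m, ∑ j ∈ Finset.Icc 1 n, G j k = 1) (r V : ℕ → ℝ) :
    ∃ B, ∀ P, seqC n m P →
      seqRho n m G P r + ∑ j ∈ Finset.Icc 1 n, seqMu n m G P j * V j ≤ B := by
  refine ⟨∑ k ∈ Finset.Icc 1 m, |r k| +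
    ∑ j ∈ Finset.Icc 1 n, (∑ k ∈ Finset.Icc 1 m, G j k) * |V j|, fun P hP => ?_⟩
  refine add_le_add (seqRho_le hG0 hG1 hP r) (Finset.sum_le_sum fun j hj => ?_)
  exact (mul_le_mul_of_nonneg_left (le_abs_self _) (seqMu_nonneg hG0 hG1 hP hj)).trans
    (mul_le_mul_of_nonneg_right (seqMu_le hG0 hG1 hP hj) (abs_nonneg _))

end Bounds

/-- The dynamic-programming value function of the sequentially observed MDP is
linear: `J_t(x) = ∑_i x i * V*_t(i)` for every nonnegative `x`, where `V*` is
computed by the per-state backward induction. -/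
theorem DP_value_linear (n m N : ℕ) (hn : 1 ≤ n) (hm : 1 ≤ m) (hN : 2 ≤ N)
    (G : ℕ → ℕ → ℕ → ℝ)
    (hG0 : ∀ i ∈ Finset.Icc 1 n, ∀ j ∈ Finset.Icc 1 n, ∀ k ∈ Finset.Icc 1 m,
      0 ≤ G i j k)
    (hG1 : ∀ i ∈ Finset.Icc 1 n, ∀ k ∈ Finset.Icc 1 m,
      ∑ j ∈ Finset.Icc 1 n, G i j k = 1)
    (r : ℕ → ℕ → ℕ → ℝ) (rN : ℕ → ℝ)
    (J : ℕ → (ℕ → ℝ) → ℝ)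
    (hJN : ∀ x : ℕ → ℝ, J N x = ∑ j ∈ Finset.Icc 1 n, x j * rN j)
    (hJ : ∀ t, 1 ≤ t → t ≤ N - 1 → ∀ x : ℕ → ℝ,
      J t x = sSup {v : ℝ | ∃ P : ℕ → ℕ → ℕ → ℝ,
        (∀ i ∈ Finset.Icc 1 n, seqC n m (P i)) ∧
        v = (∑ i ∈ Finset.Icc 1 n, x i * seqRho n m (G i) (P i) (r t i)) +
          J (t + 1) (fun j => ∑ i ∈ Finset.Icc 1 n, seqMu n m (G i) (P i) j * x i)})
    (V : ℕ → ℕ → ℝ)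
    (hVN : ∀ i, V N i = rN i)
    (hV : ∀ t, 1 ≤ t → t ≤ N - 1 → ∀ i,
      V t i = sSup {v : ℝ | ∃ P : ℕ → ℕ → ℝ, seqC n m P ∧
        v = seqRho n m (G i) P (r t i) +
          ∑ j ∈ Finset.Icc 1 n, seqMu n m (G i) P j * V (t + 1) j}) :
    ∀ t ∈ Finset.Icc 1 N, ∀ x : ℕ → ℝ, (∀ i ∈ Finset.Icc 1 n, 0 ≤ x i) →
      J t x = ∑ i ∈ Finset.Icc 1 n, x i * V t i := by
  intro t ht
  obtain ⟨ht1, htN⟩ := Finset.mem_Icc.1 ht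
  clear ht
  induction htN using Nat.decreasingInduction with
  | self =>
    intro x _
    simp only [hJN, hVN]
  | of_succ t htN ih =>
    intro x hx
    have htN' : t ≤ N - 1 := by omega
    rw [hJ t ht1 htN' x]
    simp only [hV t ht1 htN']
    rw [← sSup_sum_mul_separable (Finset.Icc 1 n) x hx (seqC n m) ⟨_, seqC_one n m⟩
      (fun i P => seqRho n m (G i) P (r t i) +
        ∑ j ∈ Finset.Icc 1 n, seqMu n m (G i) P j * V (t + 1) j)
      fun i hi => exists_forall_seqRho_add_sum_le (hG0 i hi) (hG1 i hi) (r t i) (V (t + 1))]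
    congr 1
    ext v
    refine exists_congr fun P => and_congr_right fun hP => ?_
    rw [ih (by omega) _ fun j hj => Finset.sum_nonneg fun i hi =>
      mul_nonneg (seqMu_nonneg (hG0 i hi) (hG1 i hi) (hP i hi) hj) (hx i hi)]
    simp only [mul_add, Finset.sum_add_distrib, Finset.sum_mul, Finset.mul_sum]
    rw [Finset.sum_comm (s := Finset.Icc 1 n) (t := Finset.Icc 1 n)
      (f := fun j i => seqMu n m (G i) (P i) j * x i * V (t + 1) j)]
    simp only [mul_comm (seqMu _ _ _ _ _) (x _), mul_assoc]
end

section
/- Let n, m ≥ 1 and N ≥ 2. For each state i and epoch t ∈ {1,…,N−1}, let G_i ∈ ℝ^{n×m} satisfy G_i(j,k) ≥ 0 and Σ_{j=1}^n G_i(j,k) = 1 for every k, and let r_t(i,·) ∈ ℝ^m and r_N ∈ ℝ^n be rewards. Define the standard-MDP backward induction W_N(i) = r_N(i) and W_t(i) = max over probability vectors p ∈ ℝ^m (p_k ≥ 0, Σ_k p_k = 1) of Σ_{k=1}^m p_k ( r_t(i,a_k) + Σ_{j=1}^n G_i(j,k) W_{t+1}(j) ). Define the sequential-MDP backward induction V*_N(i)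 = r_N(i) and V*_t(i) = sup over P ∈ ℝ^{n×m} with 0 ≤ P(j,k) ≤ 1 and P(j,m) = 1, of Σ_{k=1}^m (∏_{l=1}^{k-1}(1 − q_{i,l}(P))) [ q_{i,k}(P) r_t(i,a_k) + Σ_j G_i(j,k)P(j,k) V*_{t+1}(j) ], where q_{i,k}(P) = Σ_j G_i(j,k)P(j,k). Then W_t(i) ≤ V*_t(i) for every t ∈ {1,…,N} and every state i. -/
open Finset

/-- A convex combination of finitely many reals is at most one of them. -/
lemma exists_weighted_sum_le {s : Finset ℕ} (hs : s.Nonempty) (p c : ℕ → ℝ)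
    (hp : ∀ k ∈ s, 0 ≤ p k) (hp1 : ∑ k ∈ s, p k = 1) :
    ∃ a ∈ s, ∑ k ∈ s, p k * c k ≤ c a := by
  obtain ⟨a, ha, hmax⟩ := s.exists_max_image c hs
  refine ⟨a, ha, ?_⟩
  calc ∑ k ∈ s, p k * c k ≤ ∑ k ∈ s, p k * c a :=
        sum_le_sum fun k hk => mul_le_mul_of_nonneg_left (hmax k hk) (hp k hk)
    _ = c a := by rw [← sum_mul, hp1, one_mul]

/-- The expected one-step rewards of all acceptance rules are uniformly bounded. -/
lemma bddAbove_sequential_values (n m : ℕ) (g : ℕ → ℕ → ℝ)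
    (hg0 : ∀ j ∈ Icc 1 n, ∀ k ∈ Icc 1 m, 0 ≤ g j k)
    (hg1 : ∀ k ∈ Icc 1 m, ∑ j ∈ Icc 1 n, g j k = 1) (ρ U : ℕ → ℝ) :
    BddAbove {v : ℝ | ∃ P : ℕ → ℕ → ℝ,
        ((∀ j ∈ Icc 1 n, ∀ k ∈ Icc 1 m, 0 ≤ P j k ∧ P j k ≤ 1) ∧
          ∀ j ∈ Icc 1 n, P j m = 1) ∧
        v = ∑ k ∈ Icc 1 m,
          (∏ l ∈ Icc 1 (k - 1), (1 - ∑ j ∈ Icc 1 n, g j l * P j l)) *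
          ((∑ j ∈ Icc 1 n, g j k * P j k) * ρ k + ∑ j ∈ Icc 1 n, g j k * P j k * U j)} := by
  refine ⟨∑ k ∈ Icc 1 m, (|ρ k| + ∑ j ∈ Icc 1 n, g j k * |U j|), ?_⟩
  rintro v ⟨P, ⟨hP, -⟩, rfl⟩
  have q0 : ∀ k ∈ Icc 1 m, 0 ≤ ∑ j ∈ Icc 1 n, g j k * P j k := fun k hk =>
    sum_nonneg fun j hj => mul_nonneg (hg0 j hj k hk) (hP j hj k hk).1
  have q1 : ∀ k ∈ Icc 1 m, ∑ j ∈ Icc 1 n, g j k * P j k ≤ 1 := fun k hk => by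
    rw [← hg1 k hk]
    exact sum_le_sum fun j hj => mul_le_of_le_one_right (hg0 j hj k hk) (hP j hj k hk).2
  refine sum_le_sum fun k hk => ?_
  have hsub : ∀ l ∈ Icc 1 (k - 1), l ∈ Icc 1 m := fun l hl => by
    simp only [mem_Icc] at hl hk ⊢
    omega
  have prod0 : 0 ≤ ∏ l ∈ Icc 1 (k - 1), (1 - ∑ j ∈ Icc 1 n, g j l * P j l) :=
    prod_nonneg fun l hl => sub_nonneg.2 (q1 l (hsub l hl))
  have prod1 : ∏ l ∈ Icc 1 (k - 1), (1 - ∑ j ∈ Icc 1 n, g j l * P j l) ≤ 1 :=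
    prod_le_one (fun l hl => sub_nonneg.2 (q1 l (hsub l hl)))
      fun l hl => sub_le_self _ (q0 l (hsub l hl))
  have hreward : (∑ j ∈ Icc 1 n, g j k * P j k) * ρ k ≤ |ρ k| :=
    (mul_le_mul_of_nonneg_left (le_abs_self _) (q0 k hk)).trans
      (mul_le_of_le_one_left (abs_nonneg _) (q1 k hk))
  have hfuture : ∑ j ∈ Icc 1 n, g j k * P j k * U j ≤ ∑ j ∈ Icc 1 n, g j k * |U j| := by
    refine sum_le_sum fun j hj => ?_
    have hgP := mul_nonneg (hg0 j hj k hk) (hP j hj k hk).1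
    exact (mul_le_mul_of_nonneg_left (le_abs_self _) hgP).trans
      (mul_le_mul_of_nonneg_right
        (mul_le_of_le_one_right (hg0 j hj k hk) (hP j hj k hk).2) (abs_nonneg _))
  have hbound : 0 ≤ |ρ k| + ∑ j ∈ Icc 1 n, g j k * |U j| :=
    add_nonneg (abs_nonneg _)
      (sum_nonneg fun j hj => mul_nonneg (hg0 j hj k hk) (abs_nonneg _))
  exact (mul_le_mul_of_nonneg_left (add_le_add hreward hfuture) prod0).trans
    (mul_le_of_le_one_left hbound prod1)

/-- Rejecting every action before `a` and accepting `a` surely yields the value of `a`. -/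
lemma sequential_value_of_pure (n m : ℕ) (g : ℕ → ℕ → ℝ)
    (hg1 : ∀ k ∈ Icc 1 m, ∑ j ∈ Icc 1 n, g j k = 1) (ρ U : ℕ → ℝ)
    {a : ℕ} (ha : a ∈ Icc 1 m) (P : ℕ → ℕ → ℝ)
    (hP : ∀ j k, P j k = if k = a ∨ k = m then 1 else 0) :
    ∑ k ∈ Icc 1 m,
        (∏ l ∈ Icc 1 (k - 1), (1 - ∑ j ∈ Icc 1 n, g j l * P j l)) *
        ((∑ j ∈ Icc 1 n, g j k * P j k) * ρ k + ∑ j ∈ Icc 1 n, g j k * P j k * U j) =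
      ρ a + ∑ j ∈ Icc 1 n, g j a * U j := by
  have ha' := mem_Icc.1 ha
  have haccept : ∑ j ∈ Icc 1 n, g j a * P j a = 1 := by simp [hP, hg1 a ha]
  have hreject : ∀ k < a, ∀ j, P j k = 0 := fun k hk j => by
    rw [hP, if_neg (by omega)]
  rw [sum_eq_single_of_mem a ha]
  · rw [prod_eq_one, haccept]
    · simp [hP]
    · intro l hl
      have : l < a := by
        have := mem_Icc.1 hl
        omega
      simp [hreject l this]
  · intro k _ hka
    rcases lt_or_gt_of_ne hka with h | h
    · simp [hreject k h]
    · rw [prod_eq_zero (i := a), zero_mul]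
      · exact mem_Icc.2 (by omega)
      · rw [haccept, sub_self]

/-- The optimal value of the standard MDP backward induction never exceeds the
optimal value of the sequentially observed MDP backward induction:
`W_t(i) ≤ V*_t(i)` for all epochs `t` and states `i`. -/
theorem standard_MDP_le_sequential_MDP (n m N : ℕ) (hn : 1 ≤ n) (hm : 1 ≤ m)
    (hN : 2 ≤ N)
    (G : ℕ → ℕ → ℕ → ℝ)
    (hG0 : ∀ i ∈ Finset.Icc 1 n, ∀ j ∈ Finset.Icc 1 n, ∀ k ∈ Finset.Icc 1 m,
      0 ≤ G i j k)
    (hG1 : ∀ i ∈ Finset.Icc 1 n, ∀ k ∈ Finset.Icc 1 m,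
      ∑ j ∈ Finset.Icc 1 n, G i j k = 1)
    (r : ℕ → ℕ → ℕ → ℝ) (rN : ℕ → ℝ)
    (W : ℕ → ℕ → ℝ)
    (hWN : ∀ i, W N i = rN i)
    (hW : ∀ t, 1 ≤ t → t ≤ N - 1 → ∀ i,
      W t i = sSup {v : ℝ | ∃ p : ℕ → ℝ,
        (∀ k ∈ Finset.Icc 1 m, 0 ≤ p k) ∧ (∑ k ∈ Finset.Icc 1 m, p k = 1) ∧
        v = ∑ k ∈ Finset.Icc 1 m,
          p k * (r t i k + ∑ j ∈ Finset.Icc 1 n, G i j k * W (t + 1) j)})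
    (V : ℕ → ℕ → ℝ)
    (hVN : ∀ i, V N i = rN i)
    (hV : ∀ t, 1 ≤ t → t ≤ N - 1 → ∀ i,
      V t i = sSup {v : ℝ | ∃ P : ℕ → ℕ → ℝ,
        ((∀ j ∈ Finset.Icc 1 n, ∀ k ∈ Finset.Icc 1 m, 0 ≤ P j k ∧ P j k ≤ 1) ∧
          ∀ j ∈ Finset.Icc 1 n, P j m = 1) ∧
        v = ∑ k ∈ Finset.Icc 1 m,
          (∏ l ∈ Finset.Icc 1 (k - 1),
            (1 - ∑ j ∈ Finset.Icc 1 n, G i j l * P j l)) *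
          ((∑ j ∈ Finset.Icc 1 n, G i j k * P j k) * r t i k +
            ∑ j ∈ Finset.Icc 1 n, G i j k * P j k * V (t + 1) j)}) :
    ∀ t ∈ Finset.Icc 1 N, ∀ i ∈ Finset.Icc 1 n, W t i ≤ V t i := by
  intro t ht
  obtain ⟨ht1, htN⟩ := mem_Icc.1 ht
  clear ht
  induction htN using Nat.decreasingInduction with
  | self => exact fun i _ => by rw [hWN, hVN]
  | of_succ t htN ih =>
    intro i hi
    have hm1 : 1 ∈ Icc 1 m := mem_Icc.2 ⟨le_rfl, hm⟩
    rw [hW t ht1 (by omega), hV t ht1 (by omega)]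
    refine csSup_le ⟨_, fun k => if k = 1 then 1 else 0, fun k _ => ?_, ?_, rfl⟩ ?_
    · dsimp only
      split_ifs <;> norm_num
    · rw [sum_ite_eq', if_pos hm1]
    rintro v ⟨p, hp0, hp1, rfl⟩
    obtain ⟨a, ha, hle⟩ := exists_weighted_sum_le ⟨1, hm1⟩ p
      (fun k => r t i k + ∑ j ∈ Icc 1 n, G i j k * W (t + 1) j) hp0 hp1
    have hstep : r t i a + ∑ j ∈ Icc 1 n, G i j a * W (t + 1) j ≤
        r t i a + ∑ j ∈ Icc 1 n, G i j a * V (t + 1) j :=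
      add_le_add_right (sum_le_sum fun j hj =>
        mul_le_mul_of_nonneg_left (ih (by omega) j hj) (hG0 i hi j hj a ha)) _
    refine (hle.trans hstep).trans (le_csSup
      (bddAbove_sequential_values n m (G i) (hG0 i hi) (hG1 i hi) (r t i) (V (t + 1)))
      ⟨fun _ k => if k = a ∨ k = m then 1 else 0, ⟨fun j _ k _ => ?_, fun j _ => ?_⟩,
        (sequential_value_of_pure n m (G i) (hG1 i hi) (r t i) (V (t + 1)) ha _
          fun _ _ => rfl).symm⟩)
    · dsimp only
      split_ifs <;> norm_num
    · simp
end
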